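/- arXiv:2412.11843 — 2 statements merged into one kernel-verified Lean document; each statement's English description precedes it below -/
import Mathlib

section
/- Let P be the path graph on vertices v_1, v_2, ..., v_n (edges {v_i, v_{i+1}} for 1 ≤ i ≤ n−1) and let t ≥ 2 with t ≤ n. Then the path ideal I_t(P), the squarefree monomial ideal whose minimal generators are the sets {v_i, v_{i+1}, ..., v_{i+t-1}} of t consecutive vertices for 1 ≤ i ≤ n−t+1, is bridge-friendly. -/
/-- The "lcm" of a collection of supports of squarefree monomials: the union. -/
def lcmU {α : Type*} [DecidableEq α] (σ : Finset (Finset α)) : Finset α := σ.sup id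

/-- `m` is a bridge of `σ`: `m ∈ σ` and removing `m` does not change the lcm. -/
def IsBridge {α : Type*} [DecidableEq α] (σ : Finset (Finset α)) (m : Finset α) : Prop :=
  m ∈ σ ∧ lcmU (σ.erase m) = lcmU σ

/-- `m` is a gap of `σ` (relative to the generating set `M`): `m ∈ M`, `m ∉ σ`,
and adding `m` does not change the lcm. -/
def IsGap {α : Type*} [DecidableEq α] (M : Set (Finset α)) (σ : Finset (Finset α))
    (m : Finset α) : Prop :=
  m ∈ M ∧ m ∉ σ ∧ lcmU (insert m σ) = lcmU σ

/-- `m` is a true gap of `σ` w.r.t. the total order encoded by `ord`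
(`a` dominates `b` iff `ord b < ord a`). -/
def IsTrueGap {α : Type*} [DecidableEq α] (M : Set (Finset α)) (ord : Finset α → ℕ)
    (σ : Finset (Finset α)) (m : Finset α) : Prop :=
  IsGap M σ m ∧ ∀ m', IsBridge (insert m σ) m' → ord m' < ord m → IsBridge σ m'

/-- `σ` is potentially-type-2: it has a bridge dominating no true gap of `σ`. -/
def PotType2 {α : Type*} [DecidableEq α] (M : Set (Finset α)) (ord : Finset α → ℕ)
    (σ : Finset (Finset α)) : Prop :=
  ∃ m, IsBridge σ m ∧ ∀ g, IsTrueGap M ord σ g → ¬ ord g < ord m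

/-- `b` is the smallest bridge of `σ` w.r.t. the total order encoded by `ord`. -/
def IsSBridge {α : Type*} [DecidableEq α] (ord : Finset α → ℕ) (σ : Finset (Finset α))
    (b : Finset α) : Prop :=
  IsBridge σ b ∧ ∀ b', IsBridge σ b' → ord b ≤ ord b'

/-- `σ` is type-2: it is potentially-type-2, and any other potentially-type-2 `σ'` with
`σ' \ {sbridge σ'} = σ \ {sbridge σ}` satisfies `sbridge σ' ≻ sbridge σ`. -/
def Type2 {α : Type*} [DecidableEq α] (M : Set (Finset α)) (ord : Finset α → ℕ)
    (σ : Finset (Finset α)) : Prop :=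
  PotType2 M ord σ ∧ ∀ σ' : Finset (Finset α), ↑σ' ⊆ M → σ' ≠ σ → PotType2 M ord σ' →
    ∀ b b', IsSBridge ord σ b → IsSBridge ord σ' b' → σ'.erase b' = σ.erase b →
      ord b < ord b'

/-- `M` (an antichain of supports of the minimal generators of a squarefree monomial
ideal) is bridge-friendly: there is a total order on `M` (encoded by an injection
`ord : Finset α → ℕ`, where `a ≻ b` iff `ord b < ord a`) for which every
potentially-type-2 subset of `M` is type-2. -/
def BridgeFriendly {α : Type*} [DecidableEq α] (M : Set (Finset α)) : Prop :=
  ∃ ord : Finset α → ℕ, Set.InjOn ord M ∧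
    ∀ σ : Finset (Finset α), ↑σ ⊆ M → PotType2 M ord σ → Type2 M ord σ

theorem mem_lcmU {α : Type*} [DecidableEq α] {σ : Finset (Finset α)} {x : α} :
    x ∈ lcmU σ ↔ ∃ s ∈ σ, x ∈ s := by
  simp [lcmU, Finset.mem_sup]

/-- A member is a bridge iff each of its points lies in another member. -/
theorem isBridge_iff {α : Type*} [DecidableEq α] {σ : Finset (Finset α)} {m : Finset α} :
    IsBridge σ m ↔ m ∈ σ ∧ ∀ x ∈ m, ∃ s ∈ σ, s ≠ m ∧ x ∈ s := by
  refine and_congr_right fun hm => ⟨fun h x hx => ?_, fun h => ?_⟩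
  · have hx' : x ∈ lcmU (σ.erase m) := h ▸ mem_lcmU.2 ⟨m, hm, hx⟩
    obtain ⟨s, hs, hxs⟩ := mem_lcmU.1 hx'
    exact ⟨s, Finset.mem_of_mem_erase hs, Finset.ne_of_mem_erase hs, hxs⟩
  · ext x
    simp only [mem_lcmU, Finset.mem_erase]
    constructor
    · rintro ⟨s, ⟨-, hs⟩, hxs⟩
      exact ⟨s, hs, hxs⟩
    · rintro ⟨s, hs, hxs⟩
      by_cases hsm : s = m
      · obtain ⟨s', hs', hne, hxs'⟩ := h x (hsm ▸ hxs)
        exact ⟨s', ⟨hne, hs'⟩, hxs'⟩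
      · exact ⟨s, ⟨hsm, hs⟩, hxs⟩

/-- A new element whose points are all covered does not change the lcm. -/
theorem lcmU_insert_of_forall_mem {α : Type*} [DecidableEq α] {σ : Finset (Finset α)}
    {m : Finset α} (h : ∀ x ∈ m, ∃ s ∈ σ, x ∈ s) : lcmU (insert m σ) = lcmU σ := by
  have hle : m ⊆ lcmU σ := fun x hx => mem_lcmU.2 (h x hx)
  simpa [lcmU] using hle

/-- Suppose `a`, `b`, `c` increasing in the order implies `a ∩ c ⊆ b`. Then a potentially-type-2
set `σ` with smallest bridge `c` cannot agree, after removing `c`, with a set `ρ` from which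
a smallest bridge `b` below `c` has been removed: `b` would be a true gap of `σ`. -/
theorem PotType2.not_lt_of_erase_eq {α : Type*} [DecidableEq α] {M : Set (Finset α)}
    {ord : Finset α → ℕ}
    (hord : ∀ a ∈ M, ∀ b ∈ M, ∀ c ∈ M, ord a < ord b → ord b < ord c → a ∩ c ⊆ b)
    {σ ρ : Finset (Finset α)} (hσ : ↑σ ⊆ M) (hρ : ↑ρ ⊆ M) (hpot : PotType2 M ord σ)
    {b c : Finset α} (hb : IsSBridge ord ρ b) (hc : IsSBridge ord σ c)
    (heq : σ.erase c = ρ.erase b) : ¬ ord b < ord c := by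
  intro hlt
  obtain ⟨hbρ, hbcov⟩ := isBridge_iff.1 hb.1
  have hmem : ∀ s, (s ≠ c ∧ s ∈ σ) ↔ (s ≠ b ∧ s ∈ ρ) := fun s => by
    simpa only [Finset.mem_erase] using Finset.ext_iff.1 heq s
  have hbc : b ≠ c := fun h => hlt.ne (congrArg ord h)
  have hbσ : b ∉ σ := fun h => ((hmem b).1 ⟨hbc, h⟩).1 rfl
  obtain ⟨m, hm, hmgap⟩ := hpot
  refine hmgap b ⟨⟨hρ hbρ, hbσ, lcmU_insert_of_forall_mem fun x hx => ?_⟩, fun a ha hab => ?_⟩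
    (hlt.trans_le (hc.2 m hm))
  · obtain ⟨s, hs, hsb, hxs⟩ := hbcov x hx
    exact ⟨s, ((hmem s).2 ⟨hsb, hs⟩).2, hxs⟩
  · refine absurd (hb.2 a (isBridge_iff.2 ?_)) hab.not_ge
    obtain ⟨haσ, hacov⟩ := isBridge_iff.1 ha
    have hne : a ≠ b := fun h => hab.ne (congrArg ord h)
    have hac : a ≠ c := fun h => (hab.trans hlt).ne (congrArg ord h)
    have haρ : a ∈ ρ := ((hmem a).1 ⟨hac, Finset.mem_of_mem_insert_of_ne haσ hne⟩).2
    refine ⟨haρ, fun x hx => ?_⟩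
    obtain ⟨s, hs, hsa, hxs⟩ := hacov x hx
    by_cases hsb : s = b
    · exact ⟨b, hbρ, hne.symm, hsb ▸ hxs⟩
    by_cases hsc : s = c
    · exact ⟨b, hbρ, hne.symm, hord a (hρ haρ) b (hρ hbρ) c (hσ hc.1.1) hab hlt
        (Finset.mem_inter.2 ⟨hx, hsc ▸ hxs⟩)⟩
    · exact ⟨s, ((hmem s).1 ⟨hsc, Finset.mem_of_mem_insert_of_ne hs hsb⟩).2, hsa, hxs⟩

/-- A set family with an injective ranking for which `a ∩ c ⊆ b` whenever `a`, `b`, `c` have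
increasing ranks is bridge-friendly. -/
theorem bridgeFriendly_of_inter_subset {α : Type*} [DecidableEq α] {M : Set (Finset α)}
    (ord : Finset α → ℕ) (hinj : Set.InjOn ord M)
    (hord : ∀ a ∈ M, ∀ b ∈ M, ∀ c ∈ M, ord a < ord b → ord b < ord c → a ∩ c ⊆ b) :
    BridgeFriendly M := by
  refine ⟨ord, hinj, fun σ hσ hpot => ⟨hpot, fun ρ hρ hne _ c b hc hb heq => ?_⟩⟩
  refine lt_of_le_of_ne
    (not_lt.1 (hpot.not_lt_of_erase_eq hord hσ hρ hb hc heq.symm)) fun h => hne ?_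
  have hcb : c = b := hinj (hσ hc.1.1) (hρ hb.1.1) h
  subst hcb
  rw [← Finset.insert_erase hb.1.1, heq, Finset.insert_erase hc.1.1]

/-- The path ideal `I_t(P)` of the path on vertices `1, …, n`, with `2 ≤ t ≤ n`:
its minimal generators are the sets `{i, i+1, …, i+t-1}` of `t` consecutive
vertices for `1 ≤ i ≤ n - t + 1`.  It is bridge-friendly. -/
theorem pathIdeal_bridgeFriendly (n t : ℕ) (ht : 2 ≤ t) (htn : t ≤ n) :
    BridgeFriendly {s : Finset ℕ | ∃ i, 1 ≤ i ∧ i ≤ n - t + 1 ∧ s = Finset.Icc i (i + t - 1)} := by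
  have hsup : ∀ i, (Finset.Icc i (i + t - 1)).sup id = i + t - 1 := fun i =>
    le_antisymm (Finset.sup_le fun x hx => (Finset.mem_Icc.1 hx).2)
      (Finset.le_sup (f := id) (Finset.mem_Icc.2 ⟨by omega, le_rfl⟩))
  refine bridgeFriendly_of_inter_subset (fun s => s.sup id) ?_ ?_
  · rintro _ ⟨i, -, -, rfl⟩ _ ⟨j, -, -, rfl⟩ h
    simp only [hsup] at h
    obtain rfl : i = j := by omega
    rfl
  · rintro _ ⟨i, -, -, rfl⟩ _ ⟨j, -, -, rfl⟩ _ ⟨k, -, -, rfl⟩ hij hjk x hx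
    simp only [hsup] at hij hjk
    simp only [Finset.mem_inter, Finset.mem_Icc] at hx ⊢
    omega
end

section
/- Let M ⊆ ℕ^d be the (finite) antichain of exponent vectors of the minimal generators of a monomial ideal with linear quotients, witnessed by a total order ⊐ on M. Fix m ∈ M, let J_m = {j : there exists n ∈ M with m ⊐ n and lcm(n, m) = m + e_j}, for each j ∈ J_m fix a choice n_j ∈ M with m ⊐ n_j and lcm(n_j, m) = m + e_j, and set N_m = {n_j : j ∈ J_m}. Let ≻ be any total order on M such that: every element of M \ N_m is greater than every element of N_m; for j, j' ∈ J_m, n_j ≻ n_{j'} if and only if j > j'; and ≻ agrees with ⊐ on M \ N_m. Then for every σ ⊆ M with m ∈ σ, m the ⊐-maximum of σ, and σ ∩ (M \ (N_m ∪ {m})) ≠ ∅ such that v_L(σ) is defined, one has sbridge(σ ∪ {m_L(σ)}) = m_L(σ), where sbridge is taken with respect to ≻. -/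
/-- The lcm of a finite set of exponent vectors: the pointwise maximum. -/
def lcmV {d : ℕ} (σ : Finset (Fin d → ℕ)) : Fin d → ℕ := σ.sup id

/-- `ordI M i` is `ord_i(M)`, the minimum of the `i`-th exponents of the elements of
`M`. -/
noncomputable def ordI {d : ℕ} (M : Finset (Fin d → ℕ)) (i : Fin d) : ℕ := sInf ((fun m => m i) '' (M : Set (Fin d → ℕ)))

/-- `M` is the set of exponent vectors of the minimal generators of a generic monomial
ideal: whenever `m ≠ m'` in `M` satisfy `m i = m' i > ord_i(M)` for some `i`, there is
`m'' ∈ M` dividing `lcm(m, m')` with `max (m j) (m' j) > m'' j ↔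
max (m j) (m' j) > ord_j(M)` for every `j`. -/
def Generic {d : ℕ} (M : Finset (Fin d → ℕ)) : Prop :=
  ∀ m ∈ M, ∀ m' ∈ M, m ≠ m' → ∀ i, m i = m' i → m i > ordI M i →
    ∃ m'' ∈ M, m'' ≤ m ⊔ m' ∧
      ∀ j, (max (m j) (m' j) > m'' j ↔ max (m j) (m' j) > ordI M j)

/-- Given the total order encoded by `ord` (`a ≻ b` iff `ord b < ord a`), the initial
segment `{m ∈ σ | m ⪰ s}` of `σ` determined by `s`: if `σ = {m₁ ≻ ⋯ ≻ m_q}` and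
`s = m_k`, this is `{m₁, …, m_k}`. -/
def topSeg {d : ℕ} (ord : (Fin d → ℕ) → ℕ) (σ : Finset (Fin d → ℕ))
    (s : Fin d → ℕ) : Finset (Fin d → ℕ) :=
  σ.filter fun m => ord s ≤ ord m

/-- Writing `σ = {m₁ ≻ ⋯ ≻ m_q}`, the index `k` with `s = m_k` satisfies the defining
condition of `v_L(σ)`: there is `m ∈ M` with `m_k ≻ m` and `m ∣ lcm(m₁, …, m_k)`. -/
def GoodIdx {d : ℕ} (M : Finset (Fin d → ℕ)) (ord : (Fin d → ℕ) → ℕ)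
    (σ : Finset (Fin d → ℕ)) (s : Fin d → ℕ) : Prop :=
  s ∈ σ ∧ ∃ m ∈ M, ord m < ord s ∧ m ≤ lcmV (topSeg ord σ s)

/-- Writing `σ = {m₁ ≻ ⋯ ≻ m_q}`, `s = m_k` where `k = v_L(σ)`: `s` is the `≻`-least
element of `σ` whose index satisfies the defining condition of `v_L(σ)` (so `k` is the
largest such index). -/
def IsVL {d : ℕ} (M : Finset (Fin d → ℕ)) (ord : (Fin d → ℕ) → ℕ)
    (σ : Finset (Fin d → ℕ)) (s : Fin d → ℕ) : Prop :=
  GoodIdx M ord σ s ∧ ∀ s', GoodIdx M ord σ s' → ord s ≤ ord s'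

/-- `μ = m_L(σ)`: `v_L(σ)` is defined, say realized by `s = m_{v_L(σ)}`, and `μ` is the
`≻`-least element of `M` dividing `lcm(m₁, …, m_{v_L(σ)})`. -/
def IsML {d : ℕ} (M : Finset (Fin d → ℕ)) (ord : (Fin d → ℕ) → ℕ)
    (σ : Finset (Fin d → ℕ)) (μ : Fin d → ℕ) : Prop :=
  ∃ s, IsVL M ord σ s ∧ μ ∈ M ∧ μ ≤ lcmV (topSeg ord σ s) ∧
    ∀ μ' ∈ M, μ' ≤ lcmV (topSeg ord σ s) → ord μ ≤ ord μ'

/-- `m` is a bridge of `σ`: `m ∈ σ` and removing `m` does not change the lcm. -/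
def IsBridgeV {d : ℕ} (σ : Finset (Fin d → ℕ)) (m : Fin d → ℕ) : Prop :=
  m ∈ σ ∧ lcmV (σ.erase m) = lcmV σ

/-- `b = sbridge(σ)`, the `≻`-smallest bridge of `σ`, for the total order encoded by
`ord` (`a ≻ b` iff `ord b < ord a`). -/
def IsSBridgeV {d : ℕ} (ord : (Fin d → ℕ) → ℕ) (σ : Finset (Fin d → ℕ))
    (b : Fin d → ℕ) : Prop :=
  IsBridgeV σ b ∧ ∀ b', IsBridgeV σ b' → ord b ≤ ord b'

theorem le_lcmV {d : ℕ} {σ : Finset (Fin d → ℕ)} {a : Fin d → ℕ} (h : a ∈ σ) : a ≤ lcmV σ :=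
  Finset.le_sup (f := id) h

theorem lcmV_mono {d : ℕ} {σ τ : Finset (Fin d → ℕ)} (h : σ ⊆ τ) : lcmV σ ≤ lcmV τ :=
  Finset.sup_mono h

/-- A strict lower bound on an exponent of an lcm holds already for one of the elements. -/
theorem exists_lt_apply_of_lt_lcmV {d : ℕ} {σ : Finset (Fin d → ℕ)} {i : Fin d} {k : ℕ}
    (h : k < lcmV σ i) : ∃ c ∈ σ, k < c i := by
  rw [lcmV, Finset.sup_apply, Finset.lt_sup_iff] at h
  exact h

theorem lcmV_erase_insert {d : ℕ} {σ : Finset (Fin d → ℕ)} {a : Fin d → ℕ}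
    (h : a ≤ lcmV (σ.erase a)) : lcmV ((insert a σ).erase a) = lcmV (insert a σ) := by
  rw [Finset.erase_insert_eq_erase]
  refine le_antisymm (lcmV_mono ((Finset.erase_subset a σ).trans (Finset.subset_insert a σ))) ?_
  refine Finset.sup_le fun b hb => ?_
  by_cases hba : b = a
  · exact hba ▸ h
  · exact le_lcmV (Finset.mem_erase.2 ⟨hba, Finset.mem_of_mem_insert_of_ne hb hba⟩)

theorem add_single_le {d : ℕ} {m L : Fin d → ℕ} {i : Fin d} (hm : m ≤ L) (hi : m i < L i) :
    m + Pi.single i 1 ≤ L := by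
  intro k
  by_cases hk : k = i
  · subst hk
    simpa using hi
  · simpa [hk] using hm k

theorem eq_of_sup_eq_add_single {d : ℕ} {m n : Fin d → ℕ} {i j : Fin d}
    (h : m ⊔ n = m + Pi.single j 1) (hi : m i < n i) : i = j := by
  by_contra hij
  have := congrFun h i
  simp only [Pi.sup_apply, Pi.add_apply, Pi.single_eq_of_ne hij, add_zero, sup_eq_left] at this
  omega

theorem apply_of_sup_eq_add_single {d : ℕ} {m n : Fin d → ℕ} {j : Fin d}
    (h : m ⊔ n = m + Pi.single j 1) : m j < n j := by
  have := congrFun h j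
  simp only [Pi.sup_apply, Pi.add_apply, Pi.single_eq_same] at this
  omega

/-- Setting of [BW02, Proposition 4.3]: `M ⊆ ℕ^d` is the antichain of exponent vectors
of the minimal generators of a monomial ideal with linear quotients, witnessed by the
total order `⊐` encoded by the injection `q` (`a ⊐ b` iff `q b < q a`).  For a fixed
`m ∈ M`: `J = J_m` consists of the indices `j` such that `lcm(n, m) = m + e_j` for some
`n ∈ M` with `m ⊐ n`; for `j ∈ J_m` the element `nn j = n_j^m ∈ M` is a fixed choice
with `m ⊐ n_j^m` and `lcm(n_j^m, m) = m + e_j`; and `Nm = N_m = {n_j^m : j ∈ J_m}`.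
The total order `≻` on `M` is encoded by the injection `ord` (`a ≻ b` iff
`ord b < ord a`): every element of `M \ N_m` dominates every element of `N_m`; on
`N_m`, `n_j^m ≻ n_{j'}^m` iff `j > j'`; and on `M \ N_m`, `≻` agrees with `⊐`. -/
theorem linearQuotients_sbridge_eq_mL {d : ℕ} (M : Finset (Fin d → ℕ))
    (hanti : ∀ m ∈ M, ∀ m' ∈ M, m ≤ m' → m = m')
    (q : (Fin d → ℕ) → ℕ) (hqinj : Set.InjOn q ↑M)
    (hLQ : ∀ m ∈ M, ∀ m' ∈ M, q m' < q m →
      ∃ m'' ∈ M, ∃ g : Fin d, q m'' < q m ∧ m ⊔ m'' = m + Pi.single g 1 ∧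
        m + Pi.single g 1 ≤ m ⊔ m')
    (m : Fin d → ℕ) (hm : m ∈ M)
    (J : Finset (Fin d))
    (hJ : ∀ j : Fin d, j ∈ J ↔ ∃ n ∈ M, q n < q m ∧ m ⊔ n = m + Pi.single j 1)
    (nn : Fin d → (Fin d → ℕ))
    (hnn : ∀ j ∈ J, nn j ∈ M ∧ q (nn j) < q m ∧ m ⊔ nn j = m + Pi.single j 1)
    (Nm : Finset (Fin d → ℕ)) (hNm : Nm = J.image nn)
    (ord : (Fin d → ℕ) → ℕ) (hordinj : Set.InjOn ord ↑M)
    (hord₁ : ∀ a ∈ M, a ∉ Nm → ∀ b ∈ Nm, ord b < ord a)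
    (hord₂ : ∀ j ∈ J, ∀ j' ∈ J, (ord (nn j') < ord (nn j) ↔ j' < j))
    (hord₃ : ∀ a ∈ M, ∀ b ∈ M, a ∉ Nm → b ∉ Nm → (ord b < ord a ↔ q b < q a)) :
    ∀ σ ⊆ M, m ∈ σ → (∀ s ∈ σ, q s ≤ q m) →
      (∃ s ∈ σ, s ∉ Nm ∧ s ≠ m) →
      ∀ μ, IsML M ord σ μ → IsSBridgeV ord (insert μ σ) μ := by
  intro σ hσ hmσ hmax ⟨t, htσ, htN, htm⟩ μ ⟨s, ⟨⟨hsσ, w, hwM, hws, hwL⟩, hsmin⟩, hμM, hμL, hμmin⟩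
  have mem_nn : ∀ j ∈ J, nn j ∈ Nm := fun j hj => hNm ▸ Finset.mem_image_of_mem nn hj
  have exists_nn : ∀ a ∈ Nm, ∃ j ∈ J, nn j = a := fun a ha => by simpa [hNm] using ha
  have hmN : m ∉ Nm := fun h => by
    obtain ⟨j, hj, hjm⟩ := exists_nn m h
    exact absurd (hnn j hj).2.1 (by simp [hjm])
  have q_lt : ∀ c ∈ σ, c ≠ m → q c < q m := fun c hc hcm =>
    lt_of_le_of_ne (hmax c hc) fun h => hcm (hqinj (hσ hc) hm h)
  have ord_lt : ∀ c ∈ σ, c ∉ Nm → c ≠ m → ord c < ord m := fun c hc hcN hcm =>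
    (hord₃ m hm c (hσ hc) hmN hcN).2 (q_lt c hc hcm)
  have exists_nn_le : ∀ c ∈ σ, c ≠ m → ∃ g ∈ J, nn g ≤ m ⊔ c := fun c hc hcm => by
    obtain ⟨n, hn, g, hq, he, hle⟩ := hLQ m hm c (hσ hc) (q_lt c hc hcm)
    have hg : g ∈ J := (hJ g).2 ⟨n, hn, hq, he⟩
    exact ⟨g, hg, le_sup_right.trans ((hnn g hg).2.2.le.trans hle)⟩
  have sup_le_seg : ∀ c ∈ σ, ord s ≤ ord m → ord s ≤ ord c → m ⊔ c ≤ lcmV (topSeg ord σ s) :=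
    fun c hc h₁ h₂ => sup_le (le_lcmV (Finset.mem_filter.2 ⟨hmσ, h₁⟩))
      (le_lcmV (Finset.mem_filter.2 ⟨hc, h₂⟩))
  have le_of_notMem : ∀ c ∈ σ, c ∉ Nm → c ≠ m → ord s ≤ ord c := fun c hc hcN hcm => by
    obtain ⟨g, hg, hgle⟩ := exists_nn_le c hc hcm
    refine hsmin c ⟨hc, nn g, (hnn g hg).1, hord₁ c (hσ hc) hcN _ (mem_nn g hg), hgle.trans ?_⟩
    exact sup_le (le_lcmV (Finset.mem_filter.2 ⟨hmσ, (ord_lt c hc hcN hcm).le⟩))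
      (le_lcmV (Finset.mem_filter.2 ⟨hc, le_rfl⟩))
  have hst : ord s ≤ ord t := le_of_notMem t htσ htN htm
  have hsm : ord s ≤ ord m := hst.trans (ord_lt t htσ htN htm).le
  have hmL : m ≤ lcmV (topSeg ord σ s) := le_lcmV (Finset.mem_filter.2 ⟨hmσ, hsm⟩)
  have hμs : ord μ < ord s := (hμmin w hwM hwL).trans_lt hws
  have hμN : μ ∈ Nm := by
    by_contra h
    obtain ⟨g, hg, hgle⟩ := exists_nn_le t htσ htm
    exact absurd (hord₁ μ hμM h _ (mem_nn g hg)) (not_lt.2 (hμmin _ (hnn g hg).1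
      (hgle.trans (sup_le_seg t htσ hsm hst))))
  refine ⟨⟨Finset.mem_insert_self _ _, lcmV_erase_insert (hμL.trans (lcmV_mono fun c hc => ?_))⟩, ?_⟩
  · obtain ⟨hcσ, hcs⟩ := Finset.mem_filter.1 hc
    exact Finset.mem_erase.2 ⟨fun h => absurd hcs (by simpa [h] using hμs), hcσ⟩
  rintro b ⟨hb, hbr⟩
  by_contra! hlt
  have hbM : b ∈ M := (Finset.mem_insert.1 hb).elim (fun h => h ▸ hμM) fun h => hσ h
  have hbN : b ∈ Nm := by
    by_contra h
    exact absurd (hord₁ b hbM h μ hμN) hlt.le.not_gt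
  obtain ⟨i, hi, rfl⟩ := exists_nn b hbN
  obtain ⟨-, -, hisup⟩ := hnn i hi
  obtain ⟨c, hc, hci⟩ := exists_lt_apply_of_lt_lcmV
    (hbr ▸ (apply_of_sup_eq_add_single hisup).trans_le (le_lcmV hb i))
  obtain ⟨hcb, hc⟩ := Finset.mem_erase.1 hc
  have hcN : c ∉ Nm := fun h => by
    obtain ⟨k, hk, rfl⟩ := exists_nn c h
    exact hcb (by rw [eq_of_sup_eq_add_single (hnn k hk).2.2 hci])
  have hcσ : c ∈ σ := Finset.mem_of_mem_insert_of_ne hc fun h => hcN (h ▸ hμN)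
  have hcm : c ≠ m := fun h => absurd hci (by simp [h])
  have hcL : c ≤ lcmV (topSeg ord σ s) :=
    le_lcmV (Finset.mem_filter.2 ⟨hcσ, le_of_notMem c hcσ hcN hcm⟩)
  exact absurd (hμmin _ hbM (le_sup_right.trans (hisup.le.trans
    (add_single_le hmL (hci.trans_le (hcL i)))))) hlt.not_ge
end
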